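/- All maximal isotropic subgroups of X ⊕ Y intersecting X and Y only in {0} are equivalent under the actions of the symplectic groups of X and Y: let X and Y be isomorphic finite abelian groups equipped with symplectic forms ω_X and ω_Y, and let Z₁, Z₂ be maximal isotropic subgroups of X ⊕ Y (with respect to ω_X + ω_Y) each satisfying Zᵢ ∩ (X ⊕ 0) = {0} and Zᵢ ∩ (0 ⊕ Y) = {0}. Then there exist a symplectic automorphism s_X of X and a symplectic automorphism s_Y of Y such that the automorphism (x, y) ↦ (s_X(x), s_Y(y)) of X ⊕ Y maps Z₁ onto Z₂. -/

import Mathlib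

/-- A symplectic form on a finite abelian group, valued in ℚ/ℤ :
ℤ-bilinear, alternating and nondegenerate. -/
structure IsSymplecticForm {X : Type*} [AddCommGroup X]
    (ω : X → X → AddCircle (1 : ℚ)) : Prop where
  add_left : ∀ x x' y : X, ω (x + x') y = ω x y + ω x' y
  add_right : ∀ x y y' : X, ω x (y + y') = ω x y + ω x y'
  alternating : ∀ x : X, ω x x = 0
  nondeg : ∀ x : X, (∀ y : X, ω x y = 0) → x = 0

/-- A subgroup is isotropic for `ω` if `ω` vanishes identically on it. -/
def IsIsotropic {G : Type*} [AddCommGroup G]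
    (ω : G → G → AddCircle (1 : ℚ)) (H : AddSubgroup G) : Prop :=
  ∀ x ∈ H, ∀ y ∈ H, ω x y = 0

/-- A maximal isotropic subgroup: isotropic and not properly contained in any
isotropic subgroup. -/
def IsMaximalIsotropic {G : Type*} [AddCommGroup G]
    (ω : G → G → AddCircle (1 : ℚ)) (H : AddSubgroup G) : Prop :=
  IsIsotropic ω H ∧ ∀ K : AddSubgroup G, IsIsotropic ω K → H ≤ K → K = H

/-- The rational circle `ℚ/ℤ` embeds into the real circle `ℝ/ℤ`. -/
theorem AddCircle.exists_injective_rat_real :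
    ∃ e : AddCircle (1 : ℚ) →+ AddCircle (1 : ℝ), Function.Injective e := by
  refine ⟨QuotientAddGroup.map _ _ (Rat.castHom ℝ).toAddMonoidHom ?_, ?_⟩
  · intro q hq
    obtain ⟨n, rfl⟩ := AddSubgroup.mem_zmultiples_iff.mp hq
    exact AddSubgroup.mem_zmultiples_iff.mpr ⟨n, by simp⟩
  · rw [injective_iff_map_eq_zero]
    intro q
    induction q using QuotientAddGroup.induction_on with
    | H q =>
      intro hq
      obtain ⟨n, hn⟩ := AddSubgroup.mem_zmultiples_iff.mp
        ((QuotientAddGroup.eq_zero_iff _).mp hq)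
      refine (QuotientAddGroup.eq_zero_iff _).mpr (AddSubgroup.mem_zmultiples_iff.mpr ⟨n, ?_⟩)
      have hn' : (n : ℝ) = (q : ℝ) := by simpa using hn
      have hnq : (n : ℚ) = q := by exact_mod_cast hn'
      simpa using hnq

/-- The `ℚ/ℤ`-valued characters of an abelian group embed into its complex-valued
characters. -/
theorem AddCircle.exists_injective_addChar (G : Type*) [AddCommGroup G] :
    ∃ F : (G →+ AddCircle (1 : ℚ)) → AddChar G ℂ, Function.Injective F := by
  obtain ⟨e, he⟩ := AddCircle.exists_injective_rat_real
  refine ⟨fun f => Circle.coeHom.compAddChar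
    (AddCircle.toCircle_addChar.compAddMonoidHom (e.comp f)), fun f g hfg => ?_⟩
  ext x
  refine he (AddCircle.injective_toCircle one_ne_zero (Circle.coe_injective ?_))
  exact DFunLike.congr_fun hfg x

theorem AddCircle.finite_addMonoidHom (G : Type*) [AddCommGroup G] [Finite G] :
    Finite (G →+ AddCircle (1 : ℚ)) :=
  let ⟨_, hF⟩ := AddCircle.exists_injective_addChar G
  Finite.of_injective _ hF

theorem AddCircle.card_addMonoidHom_le (G : Type*) [AddCommGroup G] [Finite G] :
    Nat.card (G →+ AddCircle (1 : ℚ)) ≤ Nat.card G := by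
  obtain ⟨F, hF⟩ := AddCircle.exists_injective_addChar G
  have := Fintype.ofFinite G
  calc Nat.card (G →+ AddCircle (1 : ℚ)) ≤ Nat.card (AddChar G ℂ) :=
        Nat.card_le_card_of_injective F hF
    _ ≤ Nat.card G := by
        rw [Nat.card_eq_fintype_card, Nat.card_eq_fintype_card]
        exact AddChar.card_addChar_le G ℂ

/-- A maximal isotropic subgroup for an alternating biadditive map contains its orthogonal. -/
theorem IsMaximalIsotropic.mem_of_orthogonal {G : Type*} [AddCommGroup G]
    {B : G →+ G →+ AddCircle (1 : ℚ)} (hB : ∀ x, B x x = 0) {H : AddSubgroup G}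
    (hH : IsMaximalIsotropic (fun x y => B x y) H) {v : G} (hv : ∀ h ∈ H, B v h = 0) :
    v ∈ H := by
  have hv' : ∀ h ∈ H, B h v = 0 := fun h hh => by
    have := hB (v + h)
    simpa [hB, hv h hh] using this
  have hK : IsIsotropic (fun x y => B x y) (H ⊔ AddSubgroup.zmultiples v) := by
    intro x hx y hy
    obtain ⟨a, ha, b, hb, rfl⟩ := AddSubgroup.mem_sup.mp hx
    obtain ⟨c, hc, d, hd, rfl⟩ := AddSubgroup.mem_sup.mp hy
    obtain ⟨m, rfl⟩ := AddSubgroup.mem_zmultiples_iff.mp hb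
    obtain ⟨n, rfl⟩ := AddSubgroup.mem_zmultiples_iff.mp hd
    have hac : B a c = 0 := hH.1 a ha c hc
    simp [hac, hv c hc, hv' a ha, hB]
  rw [← hH.2 _ hK le_sup_left]
  exact AddSubgroup.mem_sup_right (AddSubgroup.mem_zmultiples v)

/-- A maximal isotropic subgroup has at least the square root of the order of the group. -/
theorem IsMaximalIsotropic.card_le_sq {G : Type*} [AddCommGroup G] [Finite G]
    {B : G →+ G →+ AddCircle (1 : ℚ)} (hB : ∀ x, B x x = 0) {H : AddSubgroup G}
    (hH : IsMaximalIsotropic (fun x y => B x y) H) :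
    Nat.card G ≤ Nat.card H ^ 2 := by
  have := AddCircle.finite_addMonoidHom H
  let r : G →+ H →+ AddCircle (1 : ℚ) :=
    { toFun := fun v => (B v).comp H.subtype
      map_zero' := by ext; simp
      map_add' := fun v w => by ext; simp }
  have hker : r.ker ≤ H := fun v hv =>
    hH.mem_of_orthogonal hB fun h hh => DFunLike.congr_fun (AddMonoidHom.mem_ker.mp hv) ⟨h, hh⟩
  calc Nat.card G = Nat.card r.ker * Nat.card r.range := by
        rw [← AddSubgroup.index_ker, AddSubgroup.card_mul_index]
    _ ≤ Nat.card H * Nat.card H := Nat.mul_le_mul (AddSubgroup.card_le_of_le hker)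
        ((AddSubgroup.card_le_card_addGroup _).trans (AddCircle.card_addMonoidHom_le H))
    _ = Nat.card H ^ 2 := (sq _).symm

/-- A symplectic form as a bundled biadditive map. -/
def IsSymplecticForm.toAddMonoidHom {X : Type*} [AddCommGroup X]
    {ω : X → X → AddCircle (1 : ℚ)} (hω : IsSymplecticForm ω) :
    X →+ X →+ AddCircle (1 : ℚ) :=
  AddMonoidHom.mk' (fun x => AddMonoidHom.mk' (ω x) (hω.add_right x)) fun x x' => by
    ext y
    exact hω.add_left x x' y

/-- The sum of two symplectic forms as a bundled biadditive map. -/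
def IsSymplecticForm.prodAddMonoidHom {X Y : Type*} [AddCommGroup X] [AddCommGroup Y]
    {ωX : X → X → AddCircle (1 : ℚ)} {ωY : Y → Y → AddCircle (1 : ℚ)}
    (hωX : IsSymplecticForm ωX) (hωY : IsSymplecticForm ωY) :
    X × Y →+ X × Y →+ AddCircle (1 : ℚ) :=
  AddMonoidHom.mk' (fun p => (hωX.toAddMonoidHom p.1).coprod (hωY.toAddMonoidHom p.2))
    fun p q => by ext; simp [add_add_add_comm]

/-- A maximal isotropic subgroup of `X ⊕ Y` meeting both summands trivially is the graph of an
isomorphism between them. -/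
theorem IsMaximalIsotropic.exists_addEquiv {X Y : Type*} [AddCommGroup X] [AddCommGroup Y]
    [Finite X] [Finite Y] (hcard : Nat.card X = Nat.card Y)
    {ωX : X → X → AddCircle (1 : ℚ)} {ωY : Y → Y → AddCircle (1 : ℚ)}
    (hωX : IsSymplecticForm ωX) (hωY : IsSymplecticForm ωY) {Z : AddSubgroup (X × Y)}
    (hZ : IsMaximalIsotropic (fun p q : X × Y => ωX p.1 q.1 + ωY p.2 q.2) Z)
    (hZX : Z ⊓ AddSubgroup.prod ⊤ ⊥ = ⊥) (hZY : Z ⊓ AddSubgroup.prod ⊥ ⊤ = ⊥) :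
    ∃ φ : X ≃+ Y, (∀ p, p ∈ Z ↔ φ p.1 = p.2) ∧
      ∀ x x', ωY (φ x) (φ x') = -ωX x x' := by
  have hsq : Nat.card (X × Y) ≤ Nat.card Z ^ 2 :=
    IsMaximalIsotropic.card_le_sq (B := hωX.prodAddMonoidHom hωY)
      (fun p => by
        change ωX p.1 p.1 + ωY p.2 p.2 = 0
        rw [hωX.alternating, hωY.alternating, add_zero]) hZ
  rw [Nat.card_prod, ← hcard, ← sq] at hsq
  have hle : Nat.card X ≤ Nat.card Z := (Nat.pow_le_pow_iff_left two_ne_zero).mp hsq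
  have hfst : Function.Injective ((AddMonoidHom.fst X Y).comp Z.subtype) := by
    rw [injective_iff_map_eq_zero]
    rintro ⟨p, hp⟩ (h : p.1 = 0)
    have : p ∈ Z ⊓ AddSubgroup.prod ⊥ ⊤ := ⟨hp, by simp [AddSubgroup.mem_prod, h]⟩
    rw [hZY] at this
    exact Subtype.ext this
  have hsnd : Function.Injective ((AddMonoidHom.snd X Y).comp Z.subtype) := by
    rw [injective_iff_map_eq_zero]
    rintro ⟨p, hp⟩ (h : p.2 = 0)
    have : p ∈ Z ⊓ AddSubgroup.prod ⊤ ⊥ := ⟨hp, by simp [AddSubgroup.mem_prod, h]⟩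
    rw [hZX] at this
    exact Subtype.ext this
  let e₁ : Z ≃+ X := AddEquiv.ofBijective _ (hfst.bijective_of_nat_card_le hle)
  let e₂ : Z ≃+ Y := AddEquiv.ofBijective _ (hsnd.bijective_of_nat_card_le (hcard ▸ hle))
  have hsymm : ∀ x, ((e₁.symm x : Z) : X × Y).1 = x := e₁.apply_symm_apply
  refine ⟨e₁.symm.trans e₂, fun p => ⟨fun hp => ?_, fun hp => ?_⟩, fun x x' => ?_⟩
  · have : e₁.symm p.1 = ⟨p, hp⟩ := e₁.symm_apply_eq.mpr rfl
    rw [AddEquiv.trans_apply, this]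
    rfl
  · have : ((e₁.symm p.1 : Z) : X × Y) = p := Prod.ext (hsymm _) hp
    exact this ▸ (e₁.symm p.1).2
  · have := hZ.1 _ (e₁.symm x).2 _ (e₁.symm x').2
    beta_reduce at this
    rw [hsymm, hsymm] at this
    exact eq_neg_of_add_eq_zero_right this

/-- All maximal isotropic subgroups of `X ⊕ Y` intersecting `X` and `Y` only in
`{0}` are equivalent under the actions of the symplectic groups of `X` and `Y`. -/
theorem maximal_isotropic_equivalent_under_symplectic_groups
    {X Y : Type*} [AddCommGroup X] [AddCommGroup Y] [Fintype X] [Fintype Y]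
    (hiso : Nonempty (X ≃+ Y))
    (ωX : X → X → AddCircle (1 : ℚ)) (ωY : Y → Y → AddCircle (1 : ℚ))
    (hωX : IsSymplecticForm ωX) (hωY : IsSymplecticForm ωY)
    (Z₁ Z₂ : AddSubgroup (X × Y))
    (hZ₁ : IsMaximalIsotropic (fun p q : X × Y => ωX p.1 q.1 + ωY p.2 q.2) Z₁)
    (hZ₂ : IsMaximalIsotropic (fun p q : X × Y => ωX p.1 q.1 + ωY p.2 q.2) Z₂)
    (hZ₁X : Z₁ ⊓ AddSubgroup.prod ⊤ ⊥ = ⊥) (hZ₁Y : Z₁ ⊓ AddSubgroup.prod ⊥ ⊤ = ⊥)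
    (hZ₂X : Z₂ ⊓ AddSubgroup.prod ⊤ ⊥ = ⊥) (hZ₂Y : Z₂ ⊓ AddSubgroup.prod ⊥ ⊤ = ⊥) :
    ∃ (sX : X ≃+ X) (sY : Y ≃+ Y),
      (∀ x x' : X, ωX (sX x) (sX x') = ωX x x') ∧
      (∀ y y' : Y, ωY (sY y) (sY y') = ωY y y') ∧
      Z₁.map (AddMonoidHom.prodMap sX.toAddMonoidHom sY.toAddMonoidHom) = Z₂ := by
  have hcard : Nat.card X = Nat.card Y := Nat.card_congr hiso.some.toEquiv
  obtain ⟨φ₁, hφ₁, hω₁⟩ := hZ₁.exists_addEquiv hcard hωX hωY hZ₁X hZ₁Y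
  obtain ⟨φ₂, hφ₂, hω₂⟩ := hZ₂.exists_addEquiv hcard hωX hωY hZ₂X hZ₂Y
  refine ⟨AddEquiv.refl X, φ₁.symm.trans φ₂, fun _ _ => rfl, fun y y' => ?_, ?_⟩
  · obtain ⟨x, rfl⟩ := φ₁.surjective y
    obtain ⟨x', rfl⟩ := φ₁.surjective y'
    simp [hω₁, hω₂]
  · ext p
    rw [AddSubgroup.mem_map, hφ₂]
    constructor
    · rintro ⟨q, hq, rfl⟩
      simp [← (hφ₁ q).mp hq]
    · intro hp
      exact ⟨(p.1, φ₁ p.1), (hφ₁ _).mpr rfl, Prod.ext rfl (by simpa using hp)⟩
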